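/- arXiv:hep-th/9304042 — 7 statements merged into one kernel-verified Lean document; each statement's English description precedes it below -/
import Mathlib

section
/- The r-bracket [X,Y]_* := (1/2)([rX,Y] + [X,rY]) is bilinear, skew-symmetric, and satisfies the Jacobi identity; hence it defines a second Lie algebra structure on the underlying module of 𝔤. -/
/-- The r-bracket `[X, Y]_* = (1/2)([rX, Y] + [X, rY])` associated to a linear map
`r : 𝔤 → 𝔤` on a Lie algebra `𝔤`. -/
noncomputable def rBracket {k : Type*} [Field k] {L : Type*} [LieRing L] [LieAlgebra k L]
    (r : L →ₗ[k] L) (X Y : L) : L :=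
  (2⁻¹ : k) • (⁅r X, Y⁆ + ⁅X, r Y⁆)

theorem rBracket_rBracket_of_mcybe {k : Type*} [Field k]
    {L : Type*} [LieRing L] [LieAlgebra k L] (r : L →ₗ[k] L)
    (hmcybe : ∀ X Y : L, ⁅r X, r Y⁆ = r (⁅r X, Y⁆ + ⁅X, r Y⁆) - ⁅X, Y⁆) (X Y Z : L) :
    rBracket r X (rBracket r Y Z) = ((2⁻¹ : k) * 2⁻¹) •
      (⁅r X, ⁅r Y, Z⁆⁆ + ⁅r X, ⁅Y, r Z⁆⁆ + ⁅X, ⁅r Y, r Z⁆⁆ + ⁅X, ⁅Y, Z⁆⁆) := by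
  have h : r (⁅r Y, Z⁆ + ⁅Y, r Z⁆) = ⁅r Y, r Z⁆ + ⁅Y, Z⁆ := by
    rw [hmcybe, sub_add_cancel]
  simp only [rBracket, map_smul, h, lie_smul, lie_add, ← smul_add, smul_smul, add_assoc]

/-- If `r` satisfies the modified classical Yang–Baxter equation, then the r-bracket
`[X,Y]_* = (1/2)([rX,Y] + [X,rY])` is bilinear, skew-symmetric and satisfies the Jacobi
identity; hence it defines a second Lie algebra structure on the underlying module of `𝔤`. -/
theorem rBracket_isLieBracket {k : Type*} [Field k] [CharZero k]
    {L : Type*} [LieRing L] [LieAlgebra k L] (r : L →ₗ[k] L)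
    (hmcybe : ∀ X Y : L, ⁅r X, r Y⁆ = r (⁅r X, Y⁆ + ⁅X, r Y⁆) - ⁅X, Y⁆) :
    (∀ (a : k) (X X' Y : L),
        rBracket r (a • X + X') Y = a • rBracket r X Y + rBracket r X' Y) ∧
    (∀ (a : k) (X Y Y' : L),
        rBracket r X (a • Y + Y') = a • rBracket r X Y + rBracket r X Y') ∧
    (∀ X Y : L, rBracket r X Y = - rBracket r Y X) ∧
    (∀ X Y Z : L,
        rBracket r X (rBracket r Y Z) + rBracket r Y (rBracket r Z X) +
          rBracket r Z (rBracket r X Y) = 0) := by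
  refine ⟨fun a X X' Y => ?_, fun a X Y Y' => ?_, fun X Y => ?_, fun X Y Z => ?_⟩
  · simp only [rBracket, map_add, map_smul, add_lie, smul_lie]
    module
  · simp only [rBracket, map_add, map_smul, lie_add, lie_smul]
    module
  · rw [rBracket, rBracket, ← lie_skew (r X) Y, ← lie_skew X (r Y)]
    module
  · simp only [rBracket_rBracket_of_mcybe r hmcybe, ← smul_add]
    have h₀ := lie_jacobi X Y Z
    have h₁ := lie_jacobi (r X) (r Y) Z
    have h₂ := lie_jacobi (r X) Y (r Z)
    have h₃ := lie_jacobi X (r Y) (r Z)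
    refine smul_eq_zero_of_right _ ?_
    linear_combination (norm := abel) h₀ + h₁ + h₂ + h₃
end

section
/- The map ι : X ↦ (r_+ X, r_− X) from (𝔤, [,]_*) into the product Lie algebra 𝔤 × 𝔤 (with componentwise bracket) is an injective Lie algebra homomorphism; in particular its image ι(𝔤) is a Lie subalgebra of 𝔤 × 𝔤. -/
/-- `r_+ = (1/2)(r + id)`. -/
noncomputable def rPlus {k : Type*} [Field k] {L : Type*} [AddCommGroup L] [Module k L]
    (r : L →ₗ[k] L) : L →ₗ[k] L :=
  (2⁻¹ : k) • (r + LinearMap.id)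

/-- `r_- = (1/2)(r - id)`. -/
noncomputable def rMinus {k : Type*} [Field k] {L : Type*} [AddCommGroup L] [Module k L]
    (r : L →ₗ[k] L) : L →ₗ[k] L :=
  (2⁻¹ : k) • (r - LinearMap.id)

/-- The componentwise Lie bracket on the product `𝔤 × 𝔤`. -/
def prodBracket {L : Type*} [LieRing L] (a b : L × L) : L × L :=
  (⁅a.1, b.1⁆, ⁅a.2, b.2⁆)

/-- The difference of `r_+` and `r_-` is the identity. -/
theorem rPlus_sub_rMinus {k : Type*} [Field k] [CharZero k] {L : Type*} [AddCommGroup L]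
    [Module k L] (r : L →ₗ[k] L) (X : L) : rPlus r X - rMinus r X = X := by
  simp only [rPlus, rMinus, LinearMap.smul_apply, LinearMap.add_apply, LinearMap.sub_apply,
    LinearMap.id_apply]
  module

/-- Under the modified classical Yang–Baxter equation, `r_+` sends the r-bracket to the bracket. -/
theorem rPlus_rBracket {k : Type*} [Field k] {L : Type*} [LieRing L]
    [LieAlgebra k L] (r : L →ₗ[k] L)
    (hr : ∀ X Y : L, ⁅r X, r Y⁆ = r (⁅r X, Y⁆ + ⁅X, r Y⁆) - ⁅X, Y⁆) (X Y : L) :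
    rPlus r (rBracket r X Y) = ⁅rPlus r X, rPlus r Y⁆ := by
  simp only [rPlus, rBracket, LinearMap.smul_apply, LinearMap.add_apply, LinearMap.id_apply,
    map_smul, smul_lie, lie_smul, add_lie, lie_add, hr X Y, map_add]
  module

/-- Under the modified classical Yang–Baxter equation, `r_-` sends the r-bracket to the bracket. -/
theorem rMinus_rBracket {k : Type*} [Field k] {L : Type*} [LieRing L]
    [LieAlgebra k L] (r : L →ₗ[k] L)
    (hr : ∀ X Y : L, ⁅r X, r Y⁆ = r (⁅r X, Y⁆ + ⁅X, r Y⁆) - ⁅X, Y⁆) (X Y : L) :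
    rMinus r (rBracket r X Y) = ⁅rMinus r X, rMinus r Y⁆ := by
  simp only [rMinus, rBracket, LinearMap.smul_apply, LinearMap.sub_apply, LinearMap.id_apply,
    map_smul, smul_lie, lie_smul, sub_lie, lie_sub, hr X Y, map_add]
  module

/-- If `r` satisfies the modified classical Yang–Baxter equation, then the map
`ι : X ↦ (r₊X, r₋X)` from `(𝔤, [,]_*)` into the product Lie algebra `𝔤 × 𝔤` (with
componentwise bracket) is an injective Lie algebra homomorphism; in particular its image
is a Lie subalgebra of `𝔤 × 𝔤`, i.e. it is closed under the componentwise bracket. -/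
theorem iota_injective_lieHom {k : Type*} [Field k] [CharZero k]
    {L : Type*} [LieRing L] [LieAlgebra k L] (r : L →ₗ[k] L)
    (hmcybe : ∀ X Y : L, ⁅r X, r Y⁆ = r (⁅r X, Y⁆ + ⁅X, r Y⁆) - ⁅X, Y⁆) :
    Function.Injective (fun X : L => (rPlus r X, rMinus r X)) ∧
    (∀ X Y : L,
      (rPlus r (rBracket r X Y), rMinus r (rBracket r X Y)) =
        prodBracket (rPlus r X, rMinus r X) (rPlus r Y, rMinus r Y)) ∧
    (∀ a b : L × L, (∃ X : L, (rPlus r X, rMinus r X) = a) →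
      (∃ Y : L, (rPlus r Y, rMinus r Y) = b) →
      ∃ Z : L, (rPlus r Z, rMinus r Z) = prodBracket a b) := by
  have hom (X Y : L) : (rPlus r (rBracket r X Y), rMinus r (rBracket r X Y)) =
      prodBracket (rPlus r X, rMinus r X) (rPlus r Y, rMinus r Y) :=
    Prod.ext (rPlus_rBracket r hmcybe X Y) (rMinus_rBracket r hmcybe X Y)
  refine ⟨fun X Y h => ?_, hom, ?_⟩
  · obtain ⟨hp, hm⟩ := Prod.mk.inj h
    rw [← rPlus_sub_rMinus r X, hp, hm, rPlus_sub_rMinus]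
  · rintro _ _ ⟨X, rfl⟩ ⟨Y, rfl⟩
    exact ⟨rBracket r X Y, hom X Y⟩
end

section
/- The linear operator r_𝔡 := P_δ − P_* on 𝔤 × 𝔤, where P_δ and P_* are the projections onto 𝔤^δ and onto ι(𝔤) determined by the direct sum decomposition 𝔤 × 𝔤 = 𝔤^δ ⊕ ι(𝔤), satisfies the modified classical Yang–Baxter equation on the product Lie algebra 𝔤 × 𝔤; moreover, if B is a symmetric invariant bilinear form on 𝔤 with respect to which r is skew, then r_𝔡 is skew with respect to the bilinear form ⟪(X,X'),(Y,Y')⟫ := B(X,Y) − B(X',Y') on 𝔤 × 𝔤. -/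
/-- Explicit form of `r_𝔡`: it sends `(X, X')` to `(X' - r (X - X'), X - r (X - X'))`. -/
theorem rDouble_apply {k : Type*} [Field k] [CharZero k]
    {L : Type*} [AddCommGroup L] [Module k L] (r : L →ₗ[k] L)
    (Pδ Pstar : (L × L) →ₗ[k] (L × L))
    (hsum : ∀ v : L × L, Pδ v + Pstar v = v)
    (hPδ : ∀ v : L × L, ∃ Z : L, Pδ v = (Z, Z))
    (hPstar : ∀ v : L × L, ∃ W : L, Pstar v = (rPlus r W, rMinus r W)) (a : L × L) :
    (Pδ - Pstar) a = (a.2 - r (a.1 - a.2), a.1 - r (a.1 - a.2)) := by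
  obtain ⟨Z, hZ⟩ := hPδ a
  obtain ⟨W, hW⟩ := hPstar a
  have h := hsum a
  rw [hZ, hW] at h
  have h₁ : a.1 = Z + rPlus r W := by simp [← h]
  have h₂ : a.2 = Z + rMinus r W := by simp [← h]
  have hWa : a.1 - a.2 = W := by
    rw [h₁, h₂]
    simp only [rPlus, rMinus, LinearMap.smul_apply, LinearMap.add_apply, LinearMap.sub_apply,
      LinearMap.id_apply]
    module
  rw [LinearMap.sub_apply, hZ, hW, hWa, h₁, h₂]
  ext <;>
  · simp only [rPlus, rMinus, LinearMap.smul_apply, LinearMap.add_apply, LinearMap.sub_apply,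
      LinearMap.id_apply, Prod.fst_sub, Prod.snd_sub]
    module

/-- Let `r` satisfy the modified classical Yang–Baxter equation and let `Pδ`, `P⋆` be the
projections of `𝔤 × 𝔤` onto the diagonal `𝔤^δ` and onto `ι(𝔤) = {(r₊W, r₋W)}` determined
by the direct sum decomposition `𝔤 × 𝔤 = 𝔤^δ ⊕ ι(𝔤)`.  Then `r_𝔡 = Pδ − P⋆` satisfies the
modified classical Yang–Baxter equation on the product Lie algebra `𝔤 × 𝔤`; moreover if
`B` is a symmetric invariant bilinear form on `𝔤` for which `r` is skew, then `r_𝔡` is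
skew with respect to the form `⟪(X,X'),(Y,Y')⟫ = B(X,Y) − B(X',Y')`. -/
theorem rDouble_mcybe_and_skew {k : Type*} [Field k] [CharZero k]
    {L : Type*} [LieRing L] [LieAlgebra k L] (r : L →ₗ[k] L)
    (hmcybe : ∀ X Y : L, ⁅r X, r Y⁆ = r (⁅r X, Y⁆ + ⁅X, r Y⁆) - ⁅X, Y⁆)
    (Pδ Pstar : (L × L) →ₗ[k] (L × L))
    (hsum : ∀ v : L × L, Pδ v + Pstar v = v)
    (hPδ : ∀ v : L × L, ∃ Z : L, Pδ v = (Z, Z))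
    (hPstar : ∀ v : L × L, ∃ W : L, Pstar v = (rPlus r W, rMinus r W)) :
    (∀ a b : L × L,
        prodBracket ((Pδ - Pstar) a) ((Pδ - Pstar) b) =
          (Pδ - Pstar) (prodBracket ((Pδ - Pstar) a) b + prodBracket a ((Pδ - Pstar) b)) -
            prodBracket a b) ∧
    (∀ B : L →ₗ[k] L →ₗ[k] k,
        (∀ X Y : L, B X Y = B Y X) →
        (∀ Z X Y : L, B ⁅Z, X⁆ Y + B X ⁅Z, Y⁆ = 0) →
        (∀ X Y : L, B (r X) Y = - B X (r Y)) →
        ∀ a b : L × L,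
          B ((Pδ - Pstar) a).1 b.1 - B ((Pδ - Pstar) a).2 b.2 =
            -(B a.1 ((Pδ - Pstar) b).1 - B a.2 ((Pδ - Pstar) b).2)) := by
  have hD := rDouble_apply r Pδ Pstar hsum hPδ hPstar
  constructor
  · intro a b
    have hr := hmcybe (a.1 - a.2) (b.1 - b.2)
    have hdiff :
        ⁅a.2 - r (a.1 - a.2), b.1⁆ + ⁅a.1, b.2 - r (b.1 - b.2)⁆ -
            (⁅a.1 - r (a.1 - a.2), b.2⁆ + ⁅a.2, b.1 - r (b.1 - b.2)⁆) =
          -(⁅r (a.1 - a.2), b.1 - b.2⁆ + ⁅a.1 - a.2, r (b.1 - b.2)⁆) := by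
      simp only [sub_lie, lie_sub]
      abel
    rw [hD a, hD b, hD]
    simp only [prodBracket, Prod.fst_add, Prod.snd_add]
    rw [hdiff, map_neg, ← eq_sub_iff_add_eq.mp hr]
    ext <;>
    · simp only [Prod.fst_sub, Prod.snd_sub]
      generalize r (a.1 - a.2) = x, r (b.1 - b.2) = y
      simp only [sub_lie, lie_sub]
      abel
  · intro B _ _ hskew a b
    have hr := hskew (a.1 - a.2) (b.1 - b.2)
    rw [hD a, hD b]
    generalize r (a.1 - a.2) = x, r (b.1 - b.2) = y at hr ⊢
    simp only [map_sub, LinearMap.sub_apply] at hr ⊢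
    linear_combination -hr
end

section
/- Let B be a symmetric invariant nondegenerate bilinear form on 𝔤 with respect to which r is skew. Then the bilinear form ⟪(X,X'),(Y,Y')⟫ := B(X,Y) − B(X',Y') on the product Lie algebra 𝔤 × 𝔤 is invariant under the adjoint action of 𝔤 × 𝔤; the diagonal 𝔤^δ and the subspace ι(𝔤) = {(r_+X, r_−X)} are both isotropic with respect to ⟪,⟫; and the pairing between them reproduces B: ⟪δ(X), ι(Y)⟫ = B(X,Y) for all X, Y ∈ 𝔤. -/
/-- Let `B` be a symmetric invariant nondegenerate bilinear form on `𝔤` with respect to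
which `r` is skew.  Then the form `⟪(X,X'),(Y,Y')⟫ = B(X,Y) − B(X',Y')` on the product
Lie algebra `𝔤 × 𝔤` is invariant under the adjoint action of `𝔤 × 𝔤`; the diagonal
`𝔤^δ` and the subspace `ι(𝔤) = {(r₊X, r₋X)}` are both isotropic with respect to `⟪,⟫`;
and the pairing between them reproduces `B`: `⟪δX, ιY⟫ = B(X,Y)`. -/
theorem double_form_invariant_isotropic_pairing {k : Type*} [Field k] [CharZero k]
    {L : Type*} [LieRing L] [LieAlgebra k L] (r : L →ₗ[k] L)
    (B : L →ₗ[k] L →ₗ[k] k)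
    (hsymm : ∀ X Y : L, B X Y = B Y X)
    (hinv : ∀ Z X Y : L, B ⁅Z, X⁆ Y + B X ⁅Z, Y⁆ = 0)
    (hnondeg : ∀ X : L, (∀ Y : L, B X Y = 0) → X = 0)
    (hskew : ∀ X Y : L, B (r X) Y = - B X (r Y)) :
    (∀ a b c : L × L,
        (B (prodBracket a b).1 c.1 - B (prodBracket a b).2 c.2) +
          (B b.1 (prodBracket a c).1 - B b.2 (prodBracket a c).2) = 0) ∧
    (∀ X Y : L, B X Y - B X Y = 0 ∧
        B (rPlus r X) (rPlus r Y) - B (rMinus r X) (rMinus r Y) = 0) ∧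
    (∀ X Y : L, B X (rPlus r Y) - B X (rMinus r Y) = B X Y) := by
  refine ⟨fun a b c => ?_, fun X Y => ⟨sub_self _, ?_⟩, fun X Y => ?_⟩
  · simp only [prodBracket]
    linear_combination hinv a.1 b.1 c.1 - hinv a.2 b.2 c.2
  · simp only [rPlus, rMinus, LinearMap.smul_apply, LinearMap.add_apply, LinearMap.sub_apply,
      LinearMap.id_apply, map_smul, map_add, map_sub, smul_eq_mul]
    linear_combination (2 * (2⁻¹ : k) * 2⁻¹) * hskew X Y
  · simp only [rPlus, rMinus, LinearMap.smul_apply, LinearMap.add_apply, LinearMap.sub_apply,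
      LinearMap.id_apply, map_smul, map_add, map_sub, smul_eq_mul]
    ring
end

section
/- Let (𝔤, 𝔤^*) be a finite-dimensional Lie bialgebra. Then there exists a unique Lie algebra structure on the vector space 𝔡 = 𝔤 ⊕ 𝔤^* such that (i) the canonical embeddings of 𝔤 and of (𝔤^*, [,]_*) into 𝔡 are Lie algebra homomorphisms, and (ii) the canonical symmetric bilinear form ⟨(X₁,f₁), (X₂,f₂)⟩ := f₁(X₂) + f₂(X₁) on 𝔡 is invariant under the adjoint action of 𝔡. -/
open TensorProduct Module

section DoubleBracket

variable {k L : Type*} [Field k] [LieRing L] [LieAlgebra k L]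

/-- The cocycle condition, tested against pairs of functionals. -/
theorem apply_lie_of_cocycle {bstar : Dual k L →ₗ[k] Dual k L →ₗ[k] Dual k L}
    {φ : L →ₗ[k] L ⊗[k] L}
    (hφ : ∀ (f g : Dual k L) (X : L),
      TensorProduct.dualDistrib k L L (f ⊗ₜ g) (φ X) = bstar f g X)
    (hcocycle : ∀ X Y : L,
      φ ⁅X, Y⁆ =
        (LinearMap.rTensor L (LieAlgebra.ad k L X : L →ₗ[k] L) +
            LinearMap.lTensor L (LieAlgebra.ad k L X : L →ₗ[k] L)) (φ Y) -
          (LinearMap.rTensor L (LieAlgebra.ad k L Y : L →ₗ[k] L) +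
            LinearMap.lTensor L (LieAlgebra.ad k L Y : L →ₗ[k] L)) (φ X))
    (f g : Dual k L) (X Y : L) :
    bstar f g ⁅X, Y⁆ =
      -bstar ⁅X, f⁆ g Y - bstar f ⁅X, g⁆ Y + bstar ⁅Y, f⁆ g X + bstar f ⁅Y, g⁆ X := by
  have key (Z : L) (t : L ⊗[k] L) : TensorProduct.dualDistrib k L L (f ⊗ₜ g)
      ((LinearMap.rTensor L (LieAlgebra.ad k L Z : L →ₗ[k] L) +
        LinearMap.lTensor L (LieAlgebra.ad k L Z : L →ₗ[k] L)) t) =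
      -TensorProduct.dualDistrib k L L (⁅Z, f⁆ ⊗ₜ g) t -
        TensorProduct.dualDistrib k L L (f ⊗ₜ ⁅Z, g⁆) t := by
    induction t with
    | zero => simp
    | tmul x y => simp
    | add s t hs ht => rw [map_add, map_add, hs, ht]; simp only [map_add]; ring
  rw [← hφ, hcocycle, map_sub, key, key]
  simp only [hφ]
  ring

variable [FiniteDimensional k L]

/-- The coadjoint action on `L` of an algebra structure on its dual:
`coadjointDual bstar f X` is the vector paired by `g` with `-bstar f g X`. -/
noncomputable def coadjointDual (bstar : Dual k L →ₗ[k] Dual k L →ₗ[k] Dual k L) (f : Dual k L) :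
    L →ₗ[k] L :=
  -((evalEquiv k L).symm.toLinearMap ∘ₗ (bstar f).dualMap ∘ₗ Dual.eval k L)

@[simp]
theorem apply_coadjointDual (bstar : Dual k L →ₗ[k] Dual k L →ₗ[k] Dual k L)
    (f g : Dual k L) (X : L) : g (coadjointDual bstar f X) = -bstar f g X := by
  simp [coadjointDual]

theorem prod_dual_ext {a b : L × Dual k L} (h₁ : ∀ g : Dual k L, g a.1 = g b.1)
    (h₂ : ∀ Z : L, a.2 Z = b.2 Z) : a = b :=
  Prod.ext (sub_eq_zero.1 ((forall_dual_apply_eq_zero_iff k _).1 fun g => by simp [h₁ g]))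
    (LinearMap.ext h₂)

/-- The bracket of the double of a Lie bialgebra. -/
noncomputable def doubleBracket (bstar : Dual k L →ₗ[k] Dual k L →ₗ[k] Dual k L) :
    (L × Dual k L) →ₗ[k] (L × Dual k L) →ₗ[k] (L × Dual k L) :=
  LinearMap.mk₂ k
    (fun a b => (⁅a.1, b.1⁆ + coadjointDual bstar a.2 b.1 - coadjointDual bstar b.2 a.1,
      bstar a.2 b.2 + ⁅a.1, b.2⁆ - ⁅b.1, a.2⁆))
    (fun a b c => prod_dual_ext (fun g => by simp; ring) (fun Z => by simp; ring))
    (fun t a b => prod_dual_ext (fun g => by simp; ring) (fun Z => by simp; ring))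
    (fun a b c => prod_dual_ext (fun g => by simp; ring) (fun Z => by simp; ring))
    (fun t a b => prod_dual_ext (fun g => by simp; ring) (fun Z => by simp; ring))

theorem doubleBracket_apply (bstar : Dual k L →ₗ[k] Dual k L →ₗ[k] Dual k L)
    (a b : L × Dual k L) : doubleBracket bstar a b =
      (⁅a.1, b.1⁆ + coadjointDual bstar a.2 b.1 - coadjointDual bstar b.2 a.1,
        bstar a.2 b.2 + ⁅a.1, b.2⁆ - ⁅b.1, a.2⁆) :=
  rfl

theorem doubleBracket_jacobi {bstar : Dual k L →ₗ[k] Dual k L →ₗ[k] Dual k L}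
    (hskew : ∀ f g : Dual k L, bstar f g = -bstar g f)
    (hjacobi : ∀ f g h : Dual k L,
      bstar f (bstar g h) + bstar g (bstar h f) + bstar h (bstar f g) = 0)
    (hlie : ∀ (f g : Dual k L) (X Y : L), bstar f g ⁅X, Y⁆ =
      -bstar ⁅X, f⁆ g Y - bstar f ⁅X, g⁆ Y + bstar ⁅Y, f⁆ g X + bstar f ⁅Y, g⁆ X)
    (a b c : L × Dual k L) :
    doubleBracket bstar a (doubleBracket bstar b c) +
      doubleBracket bstar b (doubleBracket bstar c a) +
      doubleBracket bstar c (doubleBracket bstar a b) = 0 := by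
  obtain ⟨X, f⟩ := a
  obtain ⟨Y, g⟩ := b
  obtain ⟨Z, h⟩ := c
  -- Moving a functional across the adjoint action removes every nested `coadjointDual`.
  have hmove (p q : Dual k L) (U V : L) :
      p ⁅U, coadjointDual bstar q V⁆ = bstar q ⁅U, p⁆ V :=
    neg_inj.1 (apply_coadjointDual bstar q ⁅U, p⁆ V)
  have hmove' (p q : Dual k L) (U V : L) :
      p ⁅coadjointDual bstar q V, U⁆ = -bstar q ⁅U, p⁆ V := by
    rw [← lie_skew, map_neg, hmove]
  refine prod_dual_ext (fun p => ?_) (fun W => ?_)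
  · have hL := congrArg p (lie_jacobi X Y Z)
    have hj (q r : Dual k L) (V : L) := LinearMap.congr_fun (hjacobi q r p) V
    have hp (q : Dual k L) := hskew p q
    simp only [map_add, map_zero, map_neg, hp, LinearMap.add_apply, LinearMap.neg_apply,
      LinearMap.zero_apply] at hL hj
    simp only [doubleBracket_apply, Prod.fst_add, Prod.fst_zero, map_add, map_sub, map_zero,
      lie_add, lie_sub, apply_coadjointDual, hmove, hlie, LinearMap.add_apply,
      LinearMap.sub_apply]
    linear_combination hL - hj g h X - hj h f Y - hj f g Z
  · have hL := LinearMap.congr_fun (hjacobi f g h) W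
    simp only [LinearMap.add_apply, LinearMap.zero_apply] at hL
    have hlie' (p q : Dual k L) (U V : L) : bstar p q ⁅U, V⁆ =
        bstar q ⁅U, p⁆ V - bstar p ⁅U, q⁆ V - bstar q ⁅V, p⁆ U + bstar p ⁅V, q⁆ U := by
      rw [hlie, hskew ⁅U, p⁆ q, hskew ⁅V, p⁆ q]
      simp only [LinearMap.neg_apply]
      ring
    simp only [doubleBracket_apply, Prod.snd_add, Prod.snd_zero, map_add, map_sub,
      lie_add, lie_sub, add_lie, sub_lie, lie_lie, Dual.lie_apply, hmove', hlie',
      LinearMap.add_apply, LinearMap.sub_apply, LinearMap.zero_apply]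
    linear_combination hL

end DoubleBracket

/-- Let `(𝔤, 𝔤^*)` be a finite-dimensional Lie bialgebra (the map `φ : 𝔤 → 𝔤 ⊗ 𝔤` dual to
the Lie bracket `[,]_*` of `𝔤^*` is a 1-cocycle).  Then there is a unique Lie algebra
structure (a bilinear, alternating bracket satisfying the Jacobi identity) on the vector
space `𝔡 = 𝔤 ⊕ 𝔤^*` such that (i) the canonical embeddings of `𝔤` and of `(𝔤^*, [,]_*)`
into `𝔡` are Lie algebra homomorphisms, and (ii) the canonical symmetric bilinear form
`⟨(X₁,f₁),(X₂,f₂)⟩ = f₁(X₂) + f₂(X₁)` is invariant under the adjoint action of `𝔡`. -/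
theorem exists_unique_double_lie_structure {k : Type*} [Field k] [CharZero k]
    {L : Type*} [LieRing L] [LieAlgebra k L] [FiniteDimensional k L]
    (bstar : Dual k L →ₗ[k] Dual k L →ₗ[k] Dual k L)
    (hskew : ∀ f : Dual k L, bstar f f = 0)
    (hjacobi : ∀ f g h : Dual k L,
      bstar f (bstar g h) + bstar g (bstar h f) + bstar h (bstar f g) = 0)
    (φ : L →ₗ[k] L ⊗[k] L)
    (hφ : ∀ (f g : Dual k L) (X : L),
      TensorProduct.dualDistrib k L L (f ⊗ₜ g) (φ X) = bstar f g X)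
    (hcocycle : ∀ X Y : L,
      φ ⁅X, Y⁆ =
        (LinearMap.rTensor L (LieAlgebra.ad k L X : L →ₗ[k] L) +
            LinearMap.lTensor L (LieAlgebra.ad k L X : L →ₗ[k] L)) (φ Y) -
          (LinearMap.rTensor L (LieAlgebra.ad k L Y : L →ₗ[k] L) +
            LinearMap.lTensor L (LieAlgebra.ad k L Y : L →ₗ[k] L)) (φ X)) :
    ∃! br : (L × Dual k L) →ₗ[k] (L × Dual k L) →ₗ[k] (L × Dual k L),
      (∀ a : L × Dual k L, br a a = 0) ∧
      (∀ a b c : L × Dual k L, br a (br b c) + br b (br c a) + br c (br a b) = 0) ∧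
      (∀ X Y : L, br (X, 0) (Y, 0) = ((⁅X, Y⁆, 0) : L × Dual k L)) ∧
      (∀ f g : Dual k L, br (0, f) (0, g) = ((0, bstar f g) : L × Dual k L)) ∧
      (∀ a b c : L × Dual k L,
        ((br a b).2 c.1 + c.2 (br a b).1) + (b.2 (br a c).1 + (br a c).2 b.1) = 0) := by
  have hskew' (f g : Dual k L) : bstar f g = -bstar g f := by
    have h := hskew (f + g)
    simp only [map_add, LinearMap.add_apply, hskew, zero_add, add_zero] at h
    exact eq_neg_of_add_eq_zero_right h
  refine ⟨doubleBracket bstar, ⟨fun a => ?_, doubleBracket_jacobi hskew' hjacobi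
    (apply_lie_of_cocycle hφ hcocycle), fun X Y => ?_, fun f g => ?_, fun a b c => ?_⟩, ?_⟩
  · simp [doubleBracket_apply, hskew]
  · refine prod_dual_ext (fun p => ?_) (fun W => ?_) <;> simp [doubleBracket_apply]
  · refine prod_dual_ext (fun p => ?_) (fun W => ?_) <;> simp [doubleBracket_apply]
  · simp only [doubleBracket_apply, map_add, map_sub, apply_coadjointDual, Dual.lie_apply,
      LinearMap.add_apply, LinearMap.sub_apply]
    rw [hskew' c.2 b.2, ← lie_skew c.1 b.1, map_neg]
    simp only [LinearMap.neg_apply]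
    ring
  · rintro br ⟨halt, -, hL, hD, hinv⟩
    have hanti (a b : L × Dual k L) : br a b = -br b a := by
      have h := halt (a + b)
      simp only [map_add, LinearMap.add_apply, halt, zero_add, add_zero] at h
      exact eq_neg_of_add_eq_zero_right h
    have hmix (X : L) (f : Dual k L) :
        br (X, 0) (0, f) = (-coadjointDual bstar f X, ⁅X, f⁆) := by
      refine prod_dual_ext (fun g => ?_) (fun Z => ?_)
      · have h := hinv (0, f) (X, 0) (0, g)
        rw [hanti (0, f) (X, 0), hD] at h
        simp only [map_neg, map_zero, apply_coadjointDual, Prod.fst_neg, Prod.snd_neg,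
          zero_add] at h ⊢
        linear_combination -h
      · have h := hinv (X, 0) (0, f) (Z, 0)
        rw [hL] at h
        simp only [map_zero, Dual.lie_apply, LinearMap.zero_apply, add_zero] at h ⊢
        linear_combination h
    refine LinearMap.ext fun ⟨X, f⟩ => LinearMap.ext fun ⟨Y, g⟩ => ?_
    have hsplit (X : L) (f : Dual k L) : (X, f) = (X, 0) + ((0, f) : L × Dual k L) := by simp
    rw [hsplit X f, hsplit Y g]
    simp only [map_add, LinearMap.add_apply, hL, hD, hmix, hanti (0, f) (Y, 0)]
    refine prod_dual_ext (fun p => ?_) (fun W => ?_) <;> simp [doubleBracket_apply]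
end

section
/- Let ∂ be a derivation of 𝔤 which commutes with r and satisfies ∂ − ∂ ∘ r² = 0. Then the bracket on 𝔤 ⊕ k·∂ defined by [(f, α), (g, β)] := ([f,g]_* + α·∂(r g) − β·∂(r f), 0) is skew-symmetric and satisfies the Jacobi identity, i.e., it defines a Lie algebra structure on 𝔤 × k (the semi-direct product 𝔤^* ⋊ k·∂ of the dual Lie algebra with the one-dimensional algebra of the derivation). -/
/-- The bracket `[(f,α),(g,β)] = ([f,g]_* + α·∂(rg) − β·∂(rf), 0)` on `𝔤 ⊕ k·∂`. -/
noncomputable def extBracket {k : Type*} [Field k] {L : Type*} [LieRing L] [LieAlgebra k L]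
    (r D : L →ₗ[k] L) (p q : L × k) : L × k :=
  (rBracket r p.1 q.1 + p.2 • D (r q.1) - q.2 • D (r p.1), (0 : k))

section

variable {k : Type*} [Field k] {L : Type*} [LieRing L] [LieAlgebra k L]

theorem rBracket_skew (r : L →ₗ[k] L) (X Y : L) : rBracket r X Y = -rBracket r Y X := by
  rw [rBracket, rBracket, ← smul_neg, neg_add, lie_skew, lie_skew, add_comm]

theorem rBracket_add_right (r : L →ₗ[k] L) (X Y Z : L) :
    rBracket r X (Y + Z) = rBracket r X Y + rBracket r X Z := by
  simp only [rBracket, map_add, lie_add, smul_add]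
  abel

theorem rBracket_smul_right (r : L →ₗ[k] L) (a : k) (X Y : L) :
    rBracket r X (a • Y) = a • rBracket r X Y := by
  simp only [rBracket, map_smul, lie_smul, ← smul_add]
  rw [smul_comm]

theorem rBracket_sub_right (r : L →ₗ[k] L) (X Y Z : L) :
    rBracket r X (Y - Z) = rBracket r X Y - rBracket r X Z := by
  simp only [rBracket, map_sub, lie_sub, ← smul_sub]
  congr 1
  abel

/-- The iterated r-bracket, with `r` eliminated from the outside by the mCYBE. -/
theorem rBracket_rBracket (r : L →ₗ[k] L)
    (hmcybe : ∀ X Y : L, ⁅r X, r Y⁆ = r (⁅r X, Y⁆ + ⁅X, r Y⁆) - ⁅X, Y⁆) (X Y Z : L) :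
    rBracket r X (rBracket r Y Z) = (2⁻¹ : k) • (2⁻¹ : k) •
      (⁅r X, ⁅r Y, Z⁆⁆ + ⁅r X, ⁅Y, r Z⁆⁆ + ⁅X, ⁅r Y, r Z⁆⁆ + ⁅X, ⁅Y, Z⁆⁆) := by
  have h : r (⁅r Y, Z⁆ + ⁅Y, r Z⁆) = ⁅r Y, r Z⁆ + ⁅Y, Z⁆ := by rw [hmcybe]; abel
  simp only [rBracket, map_smul, h, lie_smul, ← smul_add]
  simp only [lie_add]
  congr 2
  abel

theorem rBracket_jacobi (r : L →ₗ[k] L)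
    (hmcybe : ∀ X Y : L, ⁅r X, r Y⁆ = r (⁅r X, Y⁆ + ⁅X, r Y⁆) - ⁅X, Y⁆) (X Y Z : L) :
    rBracket r X (rBracket r Y Z) + rBracket r Y (rBracket r Z X) +
      rBracket r Z (rBracket r X Y) = 0 := by
  simp only [rBracket_rBracket r hmcybe, ← smul_add]
  have h : ⁅r X, ⁅r Y, Z⁆⁆ + ⁅r X, ⁅Y, r Z⁆⁆ + ⁅X, ⁅r Y, r Z⁆⁆ + ⁅X, ⁅Y, Z⁆⁆ +
      (⁅r Y, ⁅r Z, X⁆⁆ + ⁅r Y, ⁅Z, r X⁆⁆ + ⁅Y, ⁅r Z, r X⁆⁆ + ⁅Y, ⁅Z, X⁆⁆) +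
      (⁅r Z, ⁅r X, Y⁆⁆ + ⁅r Z, ⁅X, r Y⁆⁆ + ⁅Z, ⁅r X, r Y⁆⁆ + ⁅Z, ⁅X, Y⁆⁆) =
      (⁅r X, ⁅r Y, Z⁆⁆ + ⁅r Y, ⁅Z, r X⁆⁆ + ⁅Z, ⁅r X, r Y⁆⁆) +
      (⁅r X, ⁅Y, r Z⁆⁆ + ⁅Y, ⁅r Z, r X⁆⁆ + ⁅r Z, ⁅r X, Y⁆⁆) +
      (⁅X, ⁅r Y, r Z⁆⁆ + ⁅r Y, ⁅r Z, X⁆⁆ + ⁅r Z, ⁅X, r Y⁆⁆) +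
      (⁅X, ⁅Y, Z⁆⁆ + ⁅Y, ⁅Z, X⁆⁆ + ⁅Z, ⁅X, Y⁆⁆) := by abel
  rw [h]
  simp only [lie_jacobi, add_zero, smul_zero]

/-- Under the hypotheses on `D`, the map `D ∘ r` is a derivation of the r-bracket. -/
theorem comp_rBracket (r : L →ₗ[k] L)
    (hmcybe : ∀ X Y : L, ⁅r X, r Y⁆ = r (⁅r X, Y⁆ + ⁅X, r Y⁆) - ⁅X, Y⁆)
    (D : L →ₗ[k] L)
    (hder : ∀ X Y : L, D ⁅X, Y⁆ = ⁅D X, Y⁆ + ⁅X, D Y⁆)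
    (hcomm : ∀ X : L, D (r X) = r (D X))
    (hsq : ∀ X : L, D X - D (r (r X)) = 0) (X Y : L) :
    D (r (rBracket r X Y)) = rBracket r (D (r X)) Y + rBracket r X (D (r Y)) := by
  have h : r (⁅r X, Y⁆ + ⁅X, r Y⁆) = ⁅r X, r Y⁆ + ⁅X, Y⁆ := by rw [hmcybe]; abel
  have hD : ∀ Z : L, r (D (r Z)) = D Z := fun Z => by
    rw [← hcomm, ← sub_eq_zero.mp (hsq Z)]
  simp only [rBracket, map_smul, h, map_add, hder, hD, ← smul_add]
  congr 1
  abel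

end

/-- Let `r` satisfy the modified classical Yang–Baxter equation, and let `∂` be a
derivation of `𝔤` commuting with `r` and with `∂ − ∂ ∘ r² = 0`.  Then the bracket
`[(f,α),(g,β)] = ([f,g]_* + α·∂(rg) − β·∂(rf), 0)` on `𝔤 × k` is skew-symmetric and
satisfies the Jacobi identity, i.e. it defines a Lie algebra structure on `𝔤 × k`
(the semidirect product `𝔤^* ⋊ k·∂`). -/
theorem extBracket_isLieBracket {k : Type*} [Field k] [CharZero k]
    {L : Type*} [LieRing L] [LieAlgebra k L] (r : L →ₗ[k] L)
    (hmcybe : ∀ X Y : L, ⁅r X, r Y⁆ = r (⁅r X, Y⁆ + ⁅X, r Y⁆) - ⁅X, Y⁆)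
    (D : L →ₗ[k] L)
    (hder : ∀ X Y : L, D ⁅X, Y⁆ = ⁅D X, Y⁆ + ⁅X, D Y⁆)
    (hcomm : ∀ X : L, D (r X) = r (D X))
    (hsq : ∀ X : L, D X - D (r (r X)) = 0) :
    (∀ p q : L × k, extBracket r D p q = - extBracket r D q p) ∧
    (∀ p q s : L × k,
      extBracket r D p (extBracket r D q s) + extBracket r D q (extBracket r D s p) +
        extBracket r D s (extBracket r D p q) = 0) := by
  constructor
  · intro p q
    refine Prod.ext ?_ (by simp [extBracket])
    simp only [extBracket, Prod.fst_neg]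
    rw [rBracket_skew r p.1 q.1]
    abel
  · rintro ⟨f, a⟩ ⟨g, b⟩ ⟨h, c⟩
    refine Prod.ext ?_ (by simp [extBracket])
    have hE := comp_rBracket r hmcybe D hder hcomm hsq
    have hJ := rBracket_jacobi r hmcybe f g h
    simp only [extBracket, Prod.fst_add, Prod.fst_zero, map_add, map_sub, map_smul, hE,
      rBracket_add_right, rBracket_sub_right, rBracket_smul_right, zero_smul, sub_zero]
    rw [rBracket_skew r (D (r f)) g, rBracket_skew r (D (r g)) h, rBracket_skew r (D (r h)) f]
    refine Eq.trans ?_ hJ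
    module
end

section
/- Let τ be a Lie algebra automorphism of 𝔤 which preserves the invariant symmetric bilinear form B (B(τX, τY) = B(X,Y)) and commutes with r (τ ∘ r = r ∘ τ), and let τ̂ be the automorphism (X,Y) ↦ (X, τY) of 𝔤 × 𝔤. Then the twisted operator ^τr_𝔡 := τ̂ ∘ r_𝔡 ∘ τ̂⁻¹, where r_𝔡(X,Y) = (rX − 2r_+Y, 2r_−X − rY), is given explicitly by ^τr_𝔡(X,Y) = (rX − 2 r_+(τ⁻¹Y), 2 τ(r_− X) − rY); it is skew with respect to the form ⟪(X,X'),(Y,Y')⟫ = B(X,Y) − B(X',Y') and satisfies the modified classical Yang–Baxter equation on the product Lie algebra 𝔤 × 𝔤. -/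
/-- The operator `r_𝔡(X,Y) = (rX − 2r₊Y, 2r₋X − rY)` on `𝔤 × 𝔤`. -/
noncomputable def rDouble {k : Type*} [Field k] {L : Type*} [AddCommGroup L] [Module k L]
    (r : L →ₗ[k] L) (v : L × L) : L × L :=
  (r v.1 - (2 : k) • rPlus r v.2, (2 : k) • rMinus r v.1 - r v.2)

/-- The twisted operator `^τr_𝔡 = τ̂ ∘ r_𝔡 ∘ τ̂⁻¹` where `τ̂(X,Y) = (X, τY)`. -/
noncomputable def twistedRDouble {k : Type*} [Field k] {L : Type*} [AddCommGroup L]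
    [Module k L] (r : L →ₗ[k] L) (τ : L ≃ₗ[k] L) (v : L × L) : L × L :=
  ((rDouble r (v.1, τ.symm v.2)).1, τ (rDouble r (v.1, τ.symm v.2)).2)

section

variable {k : Type*} [Field k] [CharZero k]

lemma rDouble_apply_s15 {L : Type*} [AddCommGroup L] [Module k L] (r : L →ₗ[k] L) (X Y : L) :
    rDouble r (X, Y) = (r (X - Y) - Y, r (X - Y) - X) := by
  simp only [rDouble, rPlus, rMinus, LinearMap.smul_apply, LinearMap.add_apply,
    LinearMap.sub_apply, LinearMap.id_apply, smul_inv_smul₀ (two_ne_zero : (2 : k) ≠ 0), map_sub]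
  ext <;> dsimp only <;> abel

lemma rDouble_skew {L : Type*} [AddCommGroup L] [Module k L] (r : L →ₗ[k] L)
    (B : L →ₗ[k] L →ₗ[k] k) (hskew : ∀ X Y : L, B (r X) Y = - B X (r Y)) (a b : L × L) :
    B (rDouble r a).1 b.1 - B (rDouble r a).2 b.2 =
      -(B a.1 (rDouble r b).1 - B a.2 (rDouble r b).2) := by
  obtain ⟨X, Y⟩ := a
  obtain ⟨X', Y'⟩ := b
  simp only [rDouble_apply_s15, map_sub, LinearMap.sub_apply, hskew]
  ring

lemma rDouble_mcybe {L : Type*} [LieRing L] [LieAlgebra k L] (r : L →ₗ[k] L)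
    (hmcybe : ∀ X Y : L, ⁅r X, r Y⁆ = r (⁅r X, Y⁆ + ⁅X, r Y⁆) - ⁅X, Y⁆) (a b : L × L) :
    prodBracket (rDouble r a) (rDouble r b) =
      rDouble r (prodBracket (rDouble r a) b + prodBracket a (rDouble r b)) -
        prodBracket a b := by
  obtain ⟨X, Y⟩ := a
  obtain ⟨X', Y'⟩ := b
  have h := hmcybe (X - Y) (X' - Y')
  simp only [rDouble_apply_s15, prodBracket, Prod.mk_add_mk, Prod.mk_sub_mk]
  have hdiff : ⁅r (X - Y) - Y, X'⁆ + ⁅X, r (X' - Y') - Y'⁆ -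
      (⁅r (X - Y) - X, Y'⁆ + ⁅Y, r (X' - Y') - X'⁆) =
      ⁅r (X - Y), X' - Y'⁆ + ⁅X - Y, r (X' - Y')⁆ := by
    simp only [sub_lie, lie_sub]
    abel
  rw [hdiff, ← sub_add_cancel (r (⁅r (X - Y), X' - Y'⁆ + ⁅X - Y, r (X' - Y')⁆)) ⁅X - Y, X' - Y'⁆,
    ← h]
  generalize r (X - Y) = u
  generalize r (X' - Y') = u'
  simp only [sub_lie, lie_sub]
  ext <;> dsimp only <;> abel

end

/-- Let `r` satisfy the modified classical Yang–Baxter equation and be skew with respect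
to a symmetric invariant bilinear form `B`, and let `τ` be a Lie algebra automorphism of
`𝔤` preserving `B` and commuting with `r`.  Then the twisted operator
`^τr_𝔡 = τ̂ ∘ r_𝔡 ∘ τ̂⁻¹` (with `τ̂(X,Y) = (X, τY)` and `r_𝔡(X,Y) = (rX − 2r₊Y, 2r₋X − rY)`)
is given explicitly by `^τr_𝔡(X,Y) = (rX − 2r₊(τ⁻¹Y), 2τ(r₋X) − rY)`; it is skew with
respect to `⟪(X,X'),(Y,Y')⟫ = B(X,Y) − B(X',Y')`, and it satisfies the modified classical
Yang–Baxter equation on the product Lie algebra `𝔤 × 𝔤`. -/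
theorem twistedRDouble_formula_skew_mcybe {k : Type*} [Field k] [CharZero k]
    {L : Type*} [LieRing L] [LieAlgebra k L] (r : L →ₗ[k] L)
    (hmcybe : ∀ X Y : L, ⁅r X, r Y⁆ = r (⁅r X, Y⁆ + ⁅X, r Y⁆) - ⁅X, Y⁆)
    (B : L →ₗ[k] L →ₗ[k] k)
    (hsymm : ∀ X Y : L, B X Y = B Y X)
    (hinv : ∀ Z X Y : L, B ⁅Z, X⁆ Y + B X ⁅Z, Y⁆ = 0)
    (hskew : ∀ X Y : L, B (r X) Y = - B X (r Y))
    (τ : L ≃ₗ[k] L)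
    (hτbr : ∀ X Y : L, τ ⁅X, Y⁆ = ⁅τ X, τ Y⁆)
    (hτB : ∀ X Y : L, B (τ X) (τ Y) = B X Y)
    (hτr : ∀ X : L, τ (r X) = r (τ X)) :
    (∀ X Y : L,
      twistedRDouble r τ (X, Y) =
        (r X - (2 : k) • rPlus r (τ.symm Y), (2 : k) • τ (rMinus r X) - r Y)) ∧
    (∀ a b : L × L,
      B (twistedRDouble r τ a).1 b.1 - B (twistedRDouble r τ a).2 b.2 =
        -(B a.1 (twistedRDouble r τ b).1 - B a.2 (twistedRDouble r τ b).2)) ∧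
    (∀ a b : L × L,
      prodBracket (twistedRDouble r τ a) (twistedRDouble r τ b) =
        twistedRDouble r τ
            (prodBracket (twistedRDouble r τ a) b + prodBracket a (twistedRDouble r τ b)) -
          prodBracket a b) := by
  have htwist : ∀ X Y : L, twistedRDouble r τ (X, τ Y) =
      ((rDouble r (X, Y)).1, τ (rDouble r (X, Y)).2) := fun X Y => by
    simp [twistedRDouble]
  refine ⟨fun X Y => ?_, ?_, ?_⟩
  · simp [twistedRDouble, rDouble, hτr]
  · rintro ⟨X, Y⟩ ⟨X', Y'⟩
    obtain ⟨Y, rfl⟩ := τ.surjective Y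
    obtain ⟨Y', rfl⟩ := τ.surjective Y'
    simpa only [htwist, hτB] using rDouble_skew r B hskew (X, Y) (X', Y')
  · rintro ⟨X, Y⟩ ⟨X', Y'⟩
    obtain ⟨Y, rfl⟩ := τ.surjective Y
    obtain ⟨Y', rfl⟩ := τ.surjective Y'
    have h := rDouble_mcybe r hmcybe (X, Y) (X', Y')
    simp only [prodBracket, Prod.mk_add_mk] at h
    simp only [htwist, prodBracket, ← hτbr, Prod.mk_add_mk, ← map_add]
    have hfst := congrArg Prod.fst h
    have hsnd := congrArg (fun v => τ v.2) h
    exact Prod.ext hfst (hsnd.trans (map_sub τ _ _))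
end
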